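/- arXiv:1710.09318 — 2 statements merged into one kernel-verified Lean document; each statement's English description precedes it below -/
import Mathlib

section
/- The feasible rate region X is a compact subset of ℝ^N. -/
open Finset

/-- SINR of the link from base station `i` to test point `j`, given load vector `ρ`. -/
noncomputable def gamma (M N : ℕ) (p : Fin M → ℝ) (G : Fin M → Fin N → ℝ) (s2 : ℝ)
    (ρ : Fin M → ℝ) (i : Fin M) (j : Fin N) : ℝ :=
  p i * G i j / ((∑ k ∈ Finset.univ.erase i, p k * G k j * ρ k) + s2)

/-- The load mapping `q(ρ, r)`; `serv j` is the (unique) base station serving test point `j`,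
so that `N(i) = {j | serv j = i}`. -/
noncomputable def loadMap (M N : ℕ) (p : Fin M → ℝ) (G : Fin M → Fin N → ℝ) (s2 c : ℝ)
    (serv : Fin N → Fin M) (ρ : Fin M → ℝ) (r : Fin N → ℝ) : Fin M → ℝ :=
  fun i => (1 / c) * ∑ j ∈ Finset.univ.filter (fun j => serv j = i),
    r j / Real.log (1 + gamma M N p G s2 ρ i j)

/-- A rate vector `r > 0` is feasible if the load mapping `Γ_r` has a fixed point `ρ*`
with `0 ≤ ρ* ≤ 1` componentwise. -/
def Feasible (M N : ℕ) (p : Fin M → ℝ) (G : Fin M → Fin N → ℝ) (s2 c : ℝ)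
    (serv : Fin N → Fin M) (r : Fin N → ℝ) : Prop :=
  ∃ ρ : Fin M → ℝ, (∀ i, 0 ≤ ρ i) ∧ (∀ i, ρ i ≤ 1) ∧ loadMap M N p G s2 c serv ρ r = ρ

/-- The feasible rate region `X`. -/
def FeasRegion (M N : ℕ) (p : Fin M → ℝ) (G : Fin M → Fin N → ℝ) (s2 c : ℝ)
    (serv : Fin N → Fin M) (rmin : Fin N → ℝ) : Set (Fin N → ℝ) :=
  {r | (∀ j, 0 < r j) ∧ (∀ j, rmin j ≤ r j) ∧ Feasible M N p G s2 c serv r}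

section LoadMap

variable {M N : ℕ} {p : Fin M → ℝ} {G : Fin M → Fin N → ℝ} {s2 c : ℝ} {serv : Fin N → Fin M}
  {ρ : Fin M → ℝ} {r : Fin N → ℝ}

/-- The interference-plus-noise power is at least the noise power. -/
lemma noise_le_interference_add_noise (hp : ∀ i, 0 < p i) (hG : ∀ k j, 0 ≤ G k j)
    (hρ : 0 ≤ ρ) (i : Fin M) (j : Fin N) :
    s2 ≤ (∑ k ∈ Finset.univ.erase i, p k * G k j * ρ k) + s2 :=
  le_add_of_nonneg_left <| Finset.sum_nonneg fun k _ =>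
    mul_nonneg (mul_nonneg (hp k).le (hG k j)) (hρ k)

lemma gamma_pos (hp : ∀ i, 0 < p i) (hG : ∀ k j, 0 ≤ G k j) (hs2 : 0 < s2)
    (hρ : 0 ≤ ρ) {i : Fin M} {j : Fin N} (hij : 0 < G i j) : 0 < gamma M N p G s2 ρ i j :=
  div_pos (mul_pos (hp i) hij) (hs2.trans_le (noise_le_interference_add_noise hp hG hρ i j))

/-- Interference can only decrease the SINR below the signal-to-noise ratio. -/
lemma gamma_le_snr (hp : ∀ i, 0 < p i) (hG : ∀ k j, 0 ≤ G k j) (hs2 : 0 < s2)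
    (hρ : 0 ≤ ρ) (i : Fin M) (j : Fin N) : gamma M N p G s2 ρ i j ≤ p i * G i j / s2 :=
  div_le_div_of_nonneg_left (mul_nonneg (hp i).le (hG i j)) hs2
    (noise_le_interference_add_noise hp hG hρ i j)

lemma log_one_add_gamma_pos (hp : ∀ i, 0 < p i) (hG : ∀ k j, 0 ≤ G k j) (hs2 : 0 < s2)
    (hρ : 0 ≤ ρ) {i : Fin M} {j : Fin N} (hij : 0 < G i j) :
    0 < Real.log (1 + gamma M N p G s2 ρ i j) :=
  Real.log_pos (by linarith [gamma_pos hp hG hs2 hρ hij])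

lemma continuousOn_gamma (hp : ∀ i, 0 < p i) (hG : ∀ k j, 0 ≤ G k j) (hs2 : 0 < s2)
    (i : Fin M) (j : Fin N) :
    ContinuousOn (fun ρ => gamma M N p G s2 ρ i j) (Set.Ici 0) := by
  unfold gamma
  refine ContinuousOn.div (by fun_prop) (by fun_prop) fun ρ hρ => ?_
  exact (hs2.trans_le (noise_le_interference_add_noise hp hG hρ i j)).ne'

/-- The load mapping is jointly continuous in nonnegative loads and arbitrary rates. -/
lemma continuousOn_loadMap (hp : ∀ i, 0 < p i) (hG : ∀ k j, 0 ≤ G k j) (hs2 : 0 < s2)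
    (hserv : ∀ j, 0 < G (serv j) j) :
    ContinuousOn (fun x : (Fin M → ℝ) × (Fin N → ℝ) => loadMap M N p G s2 c serv x.1 x.2)
      (Set.Ici 0 ×ˢ Set.univ) := by
  refine continuousOn_pi.2 fun i => continuousOn_const.mul <|
    continuousOn_finsetSum _ fun j hj => ?_
  obtain rfl : serv j = i := (Finset.mem_filter.1 hj).2
  have hγ : ContinuousOn (fun x : (Fin M → ℝ) × (Fin N → ℝ) => gamma M N p G s2 x.1 (serv j) j)
      (Set.Ici 0 ×ˢ Set.univ) :=
    (continuousOn_gamma hp hG hs2 (serv j) j).comp continuousOn_fst fun x hx => hx.1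
  refine ContinuousOn.div (by fun_prop) ((continuousOn_const.add hγ).log fun x hx => ?_)
    fun x hx => (log_one_add_gamma_pos hp hG hs2 hx.1 (hserv j)).ne'
  exact (add_pos one_pos (gamma_pos hp hG hs2 hx.1 (hserv j))).ne'

/-- If the serving base station is not overloaded, a rate is at most the link capacity. -/
lemma rate_le_of_loadMap_le_one (hp : ∀ i, 0 < p i) (hG : ∀ k j, 0 ≤ G k j) (hs2 : 0 < s2)
    (hc : 0 < c) (hserv : ∀ j, 0 < G (serv j) j) (hρ : 0 ≤ ρ) (hr : 0 ≤ r) (j : Fin N)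
    (hload : loadMap M N p G s2 c serv ρ r (serv j) ≤ 1) :
    r j ≤ c * Real.log (1 + p (serv j) * G (serv j) j / s2) := by
  have hlog := log_one_add_gamma_pos hp hG hs2 hρ (hserv j)
  have hsum : ∑ l ∈ Finset.univ.filter (fun l => serv l = serv j),
      r l / Real.log (1 + gamma M N p G s2 ρ (serv j) l) ≤ c := by
    rwa [loadMap, one_div, inv_mul_le_iff₀ hc, mul_one] at hload
  have hterm : r j / Real.log (1 + gamma M N p G s2 ρ (serv j) j) ≤ c := by
    have hmem : j ∈ Finset.univ.filter (fun l => serv l = serv j) := by simp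
    refine (Finset.single_le_sum
      (f := fun l => r l / Real.log (1 + gamma M N p G s2 ρ (serv j) l))
      (fun l hl => ?_) hmem).trans hsum
    have hl' : serv l = serv j := (Finset.mem_filter.1 hl).2
    exact div_nonneg (hr l) (log_one_add_gamma_pos hp hG hs2 hρ (hl' ▸ hserv l)).le
  refine ((div_le_iff₀ hlog).1 hterm).trans (mul_le_mul_of_nonneg_left ?_ hc.le)
  refine Real.log_le_log (by linarith [gamma_pos hp hG hs2 hρ (hserv j)]) ?_
  linarith [gamma_le_snr hp hG hs2 hρ (serv j) j]

end LoadMap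

/-- The feasible rate region `X` is compact. -/
theorem feasRegion_isCompact
    {M N : ℕ} (hM : 0 < M) (hN : 0 < N)
    (p : Fin M → ℝ) (hp : ∀ i, 0 < p i)
    (G : Fin M → Fin N → ℝ) (hG : ∀ k j, 0 ≤ G k j)
    (s2 : ℝ) (hs2 : 0 < s2) (c : ℝ) (hc : 0 < c)
    (serv : Fin N → Fin M) (hserv : ∀ j, 0 < G (serv j) j)
    (rmin : Fin N → ℝ) (hrmin : ∀ j, 0 < rmin j)
    (hXne : (FeasRegion M N p G s2 c serv rmin).Nonempty) :
    IsCompact (FeasRegion M N p G s2 c serv rmin) := by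
  let B : Fin N → ℝ := fun j => c * Real.log (1 + p (serv j) * G (serv j) j / s2)
  let S : Set ((Fin M → ℝ) × (Fin N → ℝ)) := Set.Icc 0 1 ×ˢ Set.Icc rmin B
  have hS : IsCompact S := isCompact_Icc.prod isCompact_Icc
  have hcont : ContinuousOn
      (fun x : (Fin M → ℝ) × (Fin N → ℝ) => loadMap M N p G s2 c serv x.1 x.2 - x.1) S :=
    ((continuousOn_loadMap hp hG hs2 hserv).mono
      (Set.prod_mono Set.Icc_subset_Ici_self (Set.subset_univ _))).sub continuousOn_fst
  have hK := hS.of_isClosed_subset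
    (hcont.preimage_isClosed_of_isClosed hS.isClosed isClosed_singleton (t := {0}))
    Set.inter_subset_left
  convert hK.image continuous_snd using 1
  ext r
  constructor
  · rintro ⟨hr, hmin, ρ, hρ0, hρ1, hfix⟩
    refine ⟨(ρ, r), ⟨⟨⟨hρ0, hρ1⟩, hmin, fun j => ?_⟩, sub_eq_zero.2 hfix⟩, rfl⟩
    exact rate_le_of_loadMap_le_one hp hG hs2 hc hserv hρ0 (fun l => (hr l).le) j
      (by rw [hfix]; exact hρ1 _)
  · rintro ⟨⟨ρ, r⟩, ⟨⟨⟨hρ0, hρ1⟩, hmin, -⟩, hfix⟩, rfl⟩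
    exact ⟨fun j => (hrmin j).trans_le (hmin j), hmin, ρ, hρ0, hρ1, sub_eq_zero.1 hfix⟩
end

section
/- Assume X is a compact subset of ℝ^N closed under componentwise maxima, the data points x^1, …, x^K lie in X, and the data is compatible. Then the midpoint approximation g is minimax optimal: for every function h : X → ℝ, sup_{f ∈ F} sup_{x ∈ X} |f(x) − g(x)| ≤ sup_{f ∈ F} sup_{x ∈ X} |f(x) − h(x)|. -/
/-- Componentwise positive part `(x)₊ = max(x, 0)`. -/
def posPartVec {n : ℕ} (x : Fin n → ℝ) : Fin n → ℝ := fun i => max (x i) 0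

/-- Euclidean norm of a finitely-indexed real vector. -/
noncomputable def euclNorm {n : ℕ} (x : Fin n → ℝ) : ℝ :=
  Real.sqrt (∑ i, x i ^ 2)

/-- The lower envelope `σ_l(x) = max_k (ρ^k − L‖(x^k − x)₊‖)`. -/
noncomputable def sigLow {N K : ℕ} (xs : Fin K → Fin N → ℝ) (vals : Fin K → ℝ)
    (L : ℝ) (x : Fin N → ℝ) : ℝ :=
  ⨆ k : Fin K, (vals k - L * euclNorm (posPartVec (xs k - x)))

/-- The upper envelope `σ_u(x) = min_k (ρ^k + L‖(x − x^k)₊‖)`. -/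
noncomputable def sigUp {N K : ℕ} (xs : Fin K → Fin N → ℝ) (vals : Fin K → ℝ)
    (L : ℝ) (x : Fin N → ℝ) : ℝ :=
  ⨅ k : Fin K, (vals k + L * euclNorm (posPartVec (x - xs k)))

/-- The midpoint approximation `g = (σ_l + σ_u)/2`. -/
noncomputable def midApprox {N K : ℕ} (xs : Fin K → Fin N → ℝ) (vals : Fin K → ℝ)
    (L : ℝ) (x : Fin N → ℝ) : ℝ :=
  (sigLow xs vals L x + sigUp xs vals L x) / 2

/-- A function is monotone on a set (componentwise order). -/
def MonotoneOnSet {n : ℕ} (f : (Fin n → ℝ) → ℝ) (X : Set (Fin n → ℝ)) : Prop :=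
  ∀ x ∈ X, ∀ y ∈ X, (∀ i, x i ≤ y i) → f x ≤ f y

/-- A function is `L`-Lipschitz on a set with respect to the Euclidean norm. -/
def LipschitzOnSet {n : ℕ} (L : ℝ) (f : (Fin n → ℝ) → ℝ) (X : Set (Fin n → ℝ)) : Prop :=
  ∀ x ∈ X, ∀ y ∈ X, |f x - f y| ≤ L * euclNorm (x - y)

/-- Membership in the class `F` of LIMF interpolants of the data: monotone on `X`,
`L`-Lipschitz on `X` (Euclidean norm), and interpolating the data. -/
def MemF {N K : ℕ} (X : Set (Fin N → ℝ)) (xs : Fin K → Fin N → ℝ) (vals : Fin K → ℝ)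
    (L : ℝ) (f : (Fin N → ℝ) → ℝ) : Prop :=
  MonotoneOnSet f X ∧ LipschitzOnSet L f X ∧ ∀ k, f (xs k) = vals k

/-- Compatibility of the data with an `L`-Lipschitz monotone function. -/
def Compatible {N K : ℕ} (xs : Fin K → Fin N → ℝ) (vals : Fin K → ℝ) (L : ℝ) : Prop :=
  ∀ k j, vals k - vals j ≤ L * euclNorm (posPartVec (xs k - xs j))

theorem euclNorm_eq_norm {n : ℕ} (x : Fin n → ℝ) : euclNorm x = ‖WithLp.toLp 2 x‖ := by
  simp [euclNorm, EuclideanSpace.norm_eq]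

theorem euclNorm_add_le {n : ℕ} (x y : Fin n → ℝ) :
    euclNorm (x + y) ≤ euclNorm x + euclNorm y := by
  simpa only [euclNorm_eq_norm, WithLp.toLp_add] using
    norm_add_le (WithLp.toLp 2 x) (WithLp.toLp 2 y)

theorem euclNorm_sub_comm {n : ℕ} (x y : Fin n → ℝ) : euclNorm (x - y) = euclNorm (y - x) := by
  simpa only [euclNorm_eq_norm, WithLp.toLp_sub] using
    norm_sub_rev (WithLp.toLp 2 x) (WithLp.toLp 2 y)

theorem euclNorm_le_of_abs_le {n : ℕ} {x y : Fin n → ℝ} (h : ∀ i, |x i| ≤ |y i|) :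
    euclNorm x ≤ euclNorm y :=
  Real.sqrt_le_sqrt (Finset.sum_le_sum fun i _ => sq_le_sq.mpr (h i))

theorem euclNorm_posPartVec_le {n : ℕ} (x : Fin n → ℝ) : euclNorm (posPartVec x) ≤ euclNorm x :=
  euclNorm_le_of_abs_le fun i => by
    rw [posPartVec, abs_of_nonneg (le_max_right _ _)]
    exact max_le (le_abs_self _) (abs_nonneg _)

theorem euclNorm_posPartVec_eq_zero {n : ℕ} {x : Fin n → ℝ} (h : ∀ i, x i ≤ 0) :
    euclNorm (posPartVec x) = 0 := by
  simp [euclNorm, posPartVec, max_eq_right (h _)]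

/-- The asymmetric distance `‖(x - y)₊‖` satisfies the triangle inequality. -/
theorem euclNorm_posPartVec_sub_le {n : ℕ} (x y z : Fin n → ℝ) :
    euclNorm (posPartVec (x - z)) ≤
      euclNorm (posPartVec (x - y)) + euclNorm (posPartVec (y - z)) := by
  refine le_trans (euclNorm_le_of_abs_le fun i => ?_) (euclNorm_add_le _ _)
  simp only [posPartVec, Pi.add_apply, Pi.sub_apply]
  have h₁ := le_max_left (x i - y i) 0
  have h₂ := le_max_right (x i - y i) 0
  have h₃ := le_max_left (y i - z i) 0
  have h₄ := le_max_right (y i - z i) 0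
  rw [abs_of_nonneg (le_max_right _ _), abs_of_nonneg (add_nonneg h₂ h₄)]
  exact max_le (by linarith) (by linarith)

/-- A function with `f x - f y ≤ L‖(x - y)₊‖` that interpolates the data lies in `F`. -/
theorem memF_of_sub_le {N K : ℕ} {X : Set (Fin N → ℝ)} {xs : Fin K → Fin N → ℝ}
    {vals : Fin K → ℝ} {L : ℝ} (hL : 0 ≤ L) {f : (Fin N → ℝ) → ℝ}
    (hf : ∀ x y, f x - f y ≤ L * euclNorm (posPartVec (x - y)))
    (hvals : ∀ k, f (xs k) = vals k) : MemF X xs vals L f := by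
  refine ⟨fun x _ y _ hxy => ?_, fun x _ y _ => ?_, hvals⟩
  · have h := hf x y
    rw [euclNorm_posPartVec_eq_zero (x := x - y) fun i => sub_nonpos.mpr (hxy i)] at h
    linarith
  · have h₁ := mul_le_mul_of_nonneg_left (euclNorm_posPartVec_le (x - y)) hL
    have h₂ := mul_le_mul_of_nonneg_left (euclNorm_posPartVec_le (y - x)) hL
    rw [euclNorm_sub_comm y x] at h₂
    exact abs_sub_le_iff.mpr ⟨(hf x y).trans h₁, (hf y x).trans h₂⟩

/-- On a set closed under componentwise maxima, monotone `L`-Lipschitz functions satisfy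
`f x - f y ≤ L‖(x - y)₊‖`. -/
theorem MonotoneOnSet.sub_le {n : ℕ} {X : Set (Fin n → ℝ)} {L : ℝ} {f : (Fin n → ℝ) → ℝ}
    (hmono : MonotoneOnSet f X) (hlip : LipschitzOnSet L f X)
    (hXmax : ∀ x ∈ X, ∀ y ∈ X, (fun i => max (x i) (y i)) ∈ X)
    {x y : Fin n → ℝ} (hx : x ∈ X) (hy : y ∈ X) :
    f x - f y ≤ L * euclNorm (posPartVec (x - y)) := by
  have hxy := hXmax x hx y hy
  have h₁ := hmono x hx _ hxy fun i => le_max_left _ _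
  have h₂ := (le_abs_self _).trans (hlip _ hxy y hy)
  have h₃ : (fun i => max (x i) (y i)) - y = posPartVec (x - y) := by
    ext i
    simp [posPartVec, ← max_sub_sub_right]
  rw [h₃] at h₂
  linarith

theorem le_sigLow {N K : ℕ} (xs : Fin K → Fin N → ℝ) (vals : Fin K → ℝ) (L : ℝ)
    (x : Fin N → ℝ) (k : Fin K) :
    vals k - L * euclNorm (posPartVec (xs k - x)) ≤ sigLow xs vals L x :=
  le_ciSup (f := fun k => vals k - L * euclNorm (posPartVec (xs k - x)))
    (Set.finite_range _).bddAbove k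

theorem sigUp_le {N K : ℕ} (xs : Fin K → Fin N → ℝ) (vals : Fin K → ℝ) (L : ℝ)
    (x : Fin N → ℝ) (k : Fin K) :
    sigUp xs vals L x ≤ vals k + L * euclNorm (posPartVec (x - xs k)) :=
  ciInf_le (f := fun k => vals k + L * euclNorm (posPartVec (x - xs k)))
    (Set.finite_range _).bddBelow k

theorem memF_sigLow {N K : ℕ} [Nonempty (Fin K)] {X : Set (Fin N → ℝ)} {xs : Fin K → Fin N → ℝ}
    {vals : Fin K → ℝ} {L : ℝ} (hL : 0 ≤ L) (hcomp : Compatible xs vals L) :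
    MemF X xs vals L (sigLow xs vals L) := by
  refine memF_of_sub_le hL (fun x y => ?_) fun j => le_antisymm (ciSup_le fun k => ?_) ?_
  · rw [sub_le_iff_le_add]
    refine ciSup_le fun k => ?_
    have h₁ := le_sigLow xs vals L y k
    have h₂ := mul_le_mul_of_nonneg_left (euclNorm_posPartVec_sub_le (xs k) x y) hL
    linarith
  · linarith [hcomp k j]
  · have h := le_sigLow xs vals L (xs j) j
    rwa [euclNorm_posPartVec_eq_zero fun i => by simp, mul_zero, sub_zero] at h

theorem memF_sigUp {N K : ℕ} [Nonempty (Fin K)] {X : Set (Fin N → ℝ)} {xs : Fin K → Fin N → ℝ}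
    {vals : Fin K → ℝ} {L : ℝ} (hL : 0 ≤ L) (hcomp : Compatible xs vals L) :
    MemF X xs vals L (sigUp xs vals L) := by
  refine memF_of_sub_le hL (fun x y => ?_) fun j => le_antisymm ?_ (le_ciInf fun k => ?_)
  · rw [sub_le_comm]
    refine le_ciInf fun k => ?_
    have h₁ := sigUp_le xs vals L x k
    have h₂ := mul_le_mul_of_nonneg_left (euclNorm_posPartVec_sub_le x y (xs k)) hL
    linarith
  · have h := sigUp_le xs vals L (xs j) j
    rwa [euclNorm_posPartVec_eq_zero fun i => by simp, mul_zero, add_zero] at h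
  · linarith [hcomp j k]

/-- Minimax optimality of the midpoint approximation `g`: for every
competing approximation `h`, the worst-case error of `g` over `F × X` is no larger than
that of `h` (expressed via upper bounds, i.e. `sup ≤ sup` in the extended reals). -/
theorem midApprox_minimax_optimal
    {N K : ℕ} (hN : 0 < N) (hK : 0 < K)
    (L : ℝ) (hL : 0 ≤ L)
    (X : Set (Fin N → ℝ)) (hXcompact : IsCompact X)
    (hXmax : ∀ x ∈ X, ∀ y ∈ X, (fun i => max (x i) (y i)) ∈ X)
    (xs : Fin K → Fin N → ℝ) (vals : Fin K → ℝ)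
    (hxs : ∀ k, xs k ∈ X)
    (hcomp : Compatible xs vals L) :
    ∀ h : (Fin N → ℝ) → ℝ, ∀ B : ℝ,
      (∀ f : (Fin N → ℝ) → ℝ, MemF X xs vals L f → ∀ x ∈ X, |f x - h x| ≤ B) →
      (∀ f : (Fin N → ℝ) → ℝ, MemF X xs vals L f → ∀ x ∈ X,
        |f x - midApprox xs vals L x| ≤ B) := by
  intro h B hB f hf x hx
  have : Nonempty (Fin K) := ⟨⟨0, hK⟩⟩
  have h_low : sigLow xs vals L x ≤ f x := ciSup_le fun k => by
    have := hf.1.sub_le hf.2.1 hXmax (hxs k) hx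
    rw [hf.2.2 k] at this
    linarith
  have h_up : f x ≤ sigUp xs vals L x := le_ciInf fun k => by
    have := hf.1.sub_le hf.2.1 hXmax hx (hxs k)
    rw [hf.2.2 k] at this
    linarith
  have hB_low := abs_le.mp (hB _ (memF_sigLow hL hcomp) x hx)
  have hB_up := abs_le.mp (hB _ (memF_sigUp hL hcomp) x hx)
  rw [midApprox, abs_le]
  constructor <;> linarith
end
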